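/- Let n ≥ 3 and let p₁, …, p_n be pairwise distinct primes greater than 3 such that for each i (indices taken cyclically modulo n) there exists k_i ∈ ZMod p_i with k_i ≠ 0 for which the elliptic curve y² = x³ + k_i over F_{p_i} has exactly p_{i+1} points (including the point at infinity). Then n = 6. -/

import Mathlib

/-- The number of `F_p`-rational points, including the point at infinity, of the elliptic curve
`y² = x³ + k` over `F_p`. -/
noncomputable def Npts (p : ℕ) (k : ZMod p) : ℕ :=
  Nat.card (WeierstrassCurve.Affine.Point
    (WeierstrassCurve.toAffine ⟨0, 0, 0, 0, k⟩))

section CharSums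

open Finset

variable {F : Type*} [Field F] [Fintype F] [DecidableEq F]

/-- The negative of the trace of Frobenius of the curve `y² = x³ + k`. -/
def cubicCharSum (k : F) : ℤ := ∑ x : F, quadraticChar F (x ^ 3 + k)

theorem sum_comp_sq (hF : ringChar F ≠ 2) (f : F → ℤ) :
    ∑ y : F, f (y ^ 2) = ∑ z : F, (1 + quadraticChar F z) * f z := by
  rw [← Finset.sum_fiberwise (s := univ) (g := fun y : F => y ^ 2)]
  refine Finset.sum_congr rfl fun z _ => ?_
  rw [Finset.sum_congr rfl (g := fun _ => f z) (by simp +contextual), Finset.sum_const,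
    nsmul_eq_mul]
  congr 1
  have := quadraticChar_card_sqrts hF z
  rw [add_comm, ← this]
  congr 2
  ext; simp

theorem sum_quadraticChar_mul_add (hF : ringChar F ≠ 2) (c : F) :
    ∑ z : F, quadraticChar F (z * (z + c)) = if c = 0 then (Fintype.card F : ℤ) - 1 else -1 := by
  have h1 : ∑ z : F, quadraticChar F (z * (z + c))
      = ∑ z : F, (quadraticChar F (1 + c * z) - if z = 0 then 1 else 0) := by
    rw [← Equiv.sum_comp (Equiv.inv F)]
    refine Finset.sum_congr rfl fun z _ => ?_
    by_cases hz : z = 0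
    · simp [hz]
    · have : z⁻¹ * (z⁻¹ + c) = (z⁻¹) ^ 2 * (1 + c * z) := by field_simp
      simp only [Equiv.inv_apply, this, map_mul, quadraticChar_sq_one' (inv_ne_zero hz), hz]
      simp
  rw [h1, Finset.sum_sub_distrib, Finset.sum_ite_eq' univ (0 : F), if_pos (mem_univ _)]
  split_ifs with hc
  · simp only [hc, zero_mul, add_zero, map_one]
    simp
  · have : ∑ z : F, quadraticChar F (1 + c * z) = ∑ z : F, quadraticChar F z :=
      Fintype.sum_bijective (fun z => 1 + c * z)
        ((AddGroup.addLeft_bijective 1).comp (mulLeft_bijective₀ c hc)) _ _ fun _ => rfl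
    rw [this, quadraticChar_sum_zero hF]
    simp

theorem sum_quadraticChar_add_mul_add (hF : ringChar F ≠ 2) (a b : F) :
    ∑ k : F, quadraticChar F (a + k) * quadraticChar F (b + k)
      = if a = b then (Fintype.card F : ℤ) - 1 else -1 := by
  have := sum_quadraticChar_mul_add hF (b - a)
  rw [← Equiv.sum_comp (Equiv.addLeft a)] at this
  simp only [sub_eq_zero, eq_comm (a := b)] at this
  rw [← this]
  refine Finset.sum_congr rfl fun z _ => ?_
  rw [← map_mul, Equiv.coe_addLeft]
  ring_nf

theorem sum_cubicCharSum_sq_arg (hF : ringChar F ≠ 2) : ∑ y : F, cubicCharSum (y ^ 2) = 0 := by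
  rw [sum_comp_sq hF]
  simp only [add_mul, one_mul, Finset.sum_add_distrib, cubicCharSum, Finset.mul_sum]
  rw [Finset.sum_comm, Finset.sum_comm (s := univ) (t := univ)
    (f := fun z x => quadraticChar F z * quadraticChar F (x ^ 3 + z))]
  have h1 : ∀ x : F, ∑ z : F, quadraticChar F (x ^ 3 + z) = 0 := fun x => by
    rw [← quadraticChar_sum_zero hF]; exact Equiv.sum_comp (Equiv.addLeft (x ^ 3)) _
  have h2 : ∀ x : F, ∑ z : F, quadraticChar F z * quadraticChar F (x ^ 3 + z)
      = (if x = 0 then (Fintype.card F : ℤ) else 0) - 1 := fun x => by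
    have := sum_quadraticChar_add_mul_add hF 0 (x ^ 3)
    simp only [zero_add, eq_comm (a := (0 : F)), pow_eq_zero_iff three_ne_zero] at this
    rw [this]; split_ifs <;> simp
  simp only [h1, h2, Finset.sum_sub_distrib, Finset.sum_ite_eq']
  simp

theorem card_filter_cube_eq (hq : Fintype.card F % 3 = 1) (x : F) :
    ((univ.filter fun y : F => x ^ 3 = y ^ 3).card : ℤ) = if x = 0 then 1 else 3 := by
  split_ifs with hx
  · subst hx
    simp [eq_comm (a := (0 : F)), Finset.filter_eq']
  · obtain ⟨ζ, hζ⟩ : ∃ ζ : Fˣ, orderOf ζ = 3 := by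
      have : Fact (Nat.Prime 3) := ⟨Nat.prime_three⟩
      apply exists_prime_orderOf_dvd_card
      rw [Fintype.card_units]; omega
    have hz3 : (ζ : F) ^ 3 = 1 := by
      rw [← Units.val_pow_eq_pow_val, ← hζ, pow_orderOf_eq_one, Units.val_one]
    have hz1 : (ζ : F) ≠ 1 := by
      intro h; rw [Units.val_eq_one] at h; simp [h] at hζ
    have hz0 : (ζ : F) ≠ 0 := ζ.ne_zero
    have hz : (ζ : F) ^ 2 + ζ + 1 = 0 := by
      apply mul_left_cancel₀ (sub_ne_zero.mpr hz1); linear_combination hz3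
    have hz2 : (ζ : F) ^ 2 ≠ 1 := by
      intro h; apply hz1; linear_combination hz3 - ζ * h
    have : (univ.filter fun y : F => x ^ 3 = y ^ 3) = {x, ζ * x, ζ ^ 2 * x} := by
      ext y
      simp only [mem_filter, mem_univ, true_and, mem_insert, mem_singleton]
      constructor
      · intro h
        have : (y - x) * ((y - ζ * x) * (y - ζ ^ 2 * x)) = 0 := by
          linear_combination -h + (y ^ 2 * x * (-1) + y * x ^ 2) * hz + (y * x ^ 2 - x ^ 3) * hz3
        simpa [sub_eq_zero] using this
      · rintro (rfl | rfl | rfl)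
        · rfl
        · linear_combination -x ^ 3 * hz3
        · linear_combination -(x ^ 3 * (ζ ^ 3 + 1)) * hz3
    rw [this, Finset.card_insert_of_notMem, Finset.card_pair]
    · rfl
    · intro h
      apply hz1
      have := mul_right_cancel₀ hx h
      apply mul_left_cancel₀ hz0
      linear_combination -this
    · simp only [mem_insert, mem_singleton, not_or]
      exact ⟨fun h => hz1 (mul_right_cancel₀ hx (by rw [one_mul]; exact h.symm)),
        fun h => hz2 (mul_right_cancel₀ hx (by rw [one_mul]; exact h.symm))⟩

theorem sum_cubicCharSum_sq (hF : ringChar F ≠ 2) (hq : Fintype.card F % 3 = 1) :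
    ∑ k : F, cubicCharSum k ^ 2 = 2 * Fintype.card F * ((Fintype.card F : ℤ) - 1) := by
  have h1 : ∀ k : F, cubicCharSum k ^ 2
      = ∑ x : F, ∑ y : F, quadraticChar F (x ^ 3 + k) * quadraticChar F (y ^ 3 + k) := fun k => by
    rw [sq, cubicCharSum, Finset.sum_mul_sum]
  have h2 : ∀ x y : F, ∑ k : F, quadraticChar F (x ^ 3 + k) * quadraticChar F (y ^ 3 + k)
      = (Fintype.card F : ℤ) * (if x ^ 3 = y ^ 3 then 1 else 0) - 1 := fun x y => by
    rw [sum_quadraticChar_add_mul_add hF]; split_ifs <;> ring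
  have h3 : ∀ x : F, ∑ y : F, ((Fintype.card F : ℤ) * (if x ^ 3 = y ^ 3 then 1 else 0) - 1)
      = (Fintype.card F : ℤ) * (2 - if x = 0 then 2 else 0) := fun x => by
    have := card_filter_cube_eq hq x
    rw [Finset.sum_sub_distrib, ← Finset.mul_sum, Finset.sum_boole, this]
    split_ifs
    · simp
    · simp; ring
  simp only [h1]
  rw [Finset.sum_comm]
  simp only [Finset.sum_comm (s := (univ : Finset F)) (t := univ)
    (f := fun k y => quadraticChar F (_ ^ 3 + k) * quadraticChar F (y ^ 3 + k)), h2, h3]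
  rw [← Finset.mul_sum, Finset.sum_sub_distrib, Finset.sum_ite_eq']
  simp
  ring

theorem cubicCharSum_cube_mul {c : F} (hc : c ≠ 0) (k : F) :
    cubicCharSum (c ^ 3 * k) = quadraticChar F c * cubicCharSum k := by
  rw [cubicCharSum, ← Equiv.sum_comp (Equiv.mulLeft₀ c hc), cubicCharSum, Finset.mul_sum]
  refine Finset.sum_congr rfl fun x _ => ?_
  have : (c * x) ^ 3 + c ^ 3 * k = c ^ 2 * (c * (x ^ 3 + k)) := by ring
  rw [Equiv.mulLeft₀_apply, this, map_mul, map_mul, quadraticChar_sq_one' hc, one_mul]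

theorem cubicCharSum_zero (hF : ringChar F ≠ 2) : cubicCharSum (0 : F) = 0 := by
  rw [cubicCharSum, ← quadraticChar_sum_zero hF]
  refine Finset.sum_congr rfl fun x _ => ?_
  by_cases hx : x = 0
  · simp [hx]
  · rw [add_zero, pow_succ, map_mul, quadraticChar_sq_one' hx, one_mul]

theorem sum_eq_sum_range_pow {g : Fˣ} (hg : ∀ x, x ∈ Subgroup.zpowers g) (f : F → ℤ)
    (h0 : f 0 = 0) : ∑ x : F, f x = ∑ j ∈ range (Fintype.card F - 1), f ((g : F) ^ j) := by
  have hord : orderOf g = Fintype.card F - 1 := by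
    rw [orderOf_eq_card_of_forall_mem_zpowers hg, Nat.card_eq_fintype_card, Fintype.card_units]
  have h1 : ∑ u : Fˣ, f u = ∑ j ∈ range (Fintype.card F - 1), f ((g : F) ^ j) := by
    rw [← IsCyclic.image_range_orderOf hg, Finset.sum_image, hord]
    · simp
    · intro a ha b hb h
      exact pow_injOn_Iio_orderOf (by simpa using ha) (by simpa using hb) h
  rw [← h1, ← Finset.sum_subset (Finset.subset_univ (univ.filter fun x : F => x ≠ 0))
    (by simp +contextual [h0])]
  symm
  refine Finset.sum_bij (fun u _ => (u : F)) (by simp) (by simp [Units.ext_iff]) ?_ (by simp)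
  intro b hb
  exact ⟨Units.mk0 b (by simpa using hb), by simp, rfl⟩

theorem sum_range_six_mul (f : ℕ → ℤ) (c : ℤ)
    (h : ∀ j, f j + f (j + 1) + f (j + 2) + f (j + 3) + f (j + 4) + f (j + 5) = c) (m : ℕ) :
    ∑ j ∈ range (6 * m), f j = m * c := by
  induction m with
  | zero => simp
  | succ m ih =>
    rw [mul_add, mul_one]
    simp only [Finset.sum_range_succ, ih]
    push_cast
    linarith [h (6 * m)]

/-- For a field with `q ≡ 1 (mod 3)` elements, the trace of `y² = x³ + k` is the trace of an
Eisenstein integer of norm `q`. -/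
theorem exists_cubicCharSum_form (hF : ringChar F ≠ 2) (hq : Fintype.card F % 3 = 1) {k : F}
    (hk : k ≠ 0) :
    ∃ u : ℤ, cubicCharSum k ^ 2 + cubicCharSum k * u + u ^ 2 = 3 * Fintype.card F := by
  obtain ⟨g, hg⟩ := IsCyclic.exists_generator (α := Fˣ)
  have hg0 : (g : F) ≠ 0 := g.ne_zero
  have hodd : Fintype.card F % 2 = 1 := FiniteField.odd_card_of_char_ne_two hF
  have hcard := Fintype.one_lt_card (α := F)
  obtain ⟨m, hm⟩ : ∃ m, Fintype.card F - 1 = 6 * m := ⟨(Fintype.card F - 1) / 6, by omega⟩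
  have hm0 : (m : ℤ) ≠ 0 := by omega
  have hgen : quadraticChar F (g : F) = -1 := by
    rw [quadraticChar_neg_one_iff_not_isSquare]
    rintro ⟨y, hy⟩
    have hy0 : y ≠ 0 := by rintro rfl; simp at hy
    have hy1 : Units.mk0 y hy0 * Units.mk0 y hy0 = g := Units.ext hy.symm
    have hord : orderOf g = Fintype.card F - 1 := by
      rw [orderOf_eq_card_of_forall_mem_zpowers hg, Nat.card_eq_fintype_card, Fintype.card_units]
    have h1 : g ^ (3 * m) = 1 := by
      rw [← hy1, ← pow_two, ← pow_mul, show 2 * (3 * m) = Fintype.card Fˣ by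
        rw [Fintype.card_units]; omega, pow_card_eq_one]
    have := Nat.le_of_dvd (by omega) (orderOf_dvd_of_pow_eq_one h1)
    omega
  obtain ⟨a, ha⟩ : ∃ a : ℕ → ℤ, ∀ j, a j = cubicCharSum ((g : F) ^ j) := ⟨_, fun _ => rfl⟩
  have ha3 : ∀ j, a (j + 3) = - a j := fun j => by
    rw [ha, ha, add_comm, pow_add, cubicCharSum_cube_mul hg0, hgen, neg_one_mul]
  have hlin : a 0 - a 1 + a 2 = 0 := by
    have h := sum_cubicCharSum_sq_arg hF
    rw [sum_eq_sum_range_pow hg (fun y => cubicCharSum (y ^ 2)) (by simp [cubicCharSum_zero hF]),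
      hm] at h
    simp only [← pow_mul, ← ha] at h
    rw [sum_range_six_mul _ (2 * (a 0 - a 1 + a 2))] at h
    · have := (mul_eq_zero.mp h).resolve_left hm0
      linarith
    · intro j
      induction j with
      | zero =>
        norm_num
        rw [ha3 1, ha3 3, ha3 0, ha3 5, ha3 2, ha3 7, ha3 4, ha3 1]
        ring
      | succ j ih =>
        have h12 : a ((j + 1 + 5) * 2) = a (j * 2) := by
          rw [show (j + 1 + 5) * 2 = j * 2 + 3 + 3 + 3 + 3 by ring]
          simp only [ha3, neg_neg]
        rw [← ih, h12]
        ring_nf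
  have hquad : a 0 ^ 2 + a 1 ^ 2 + a 2 ^ 2 = 6 * Fintype.card F := by
    have h := sum_cubicCharSum_sq hF hq
    rw [sum_eq_sum_range_pow hg (fun y => cubicCharSum y ^ 2) (by simp [cubicCharSum_zero hF]),
      hm] at h
    simp only [← ha] at h
    have hc : (Fintype.card F : ℤ) - 1 = 6 * m := by omega
    rw [sum_range_six_mul _ (2 * (a 0 ^ 2 + a 1 ^ 2 + a 2 ^ 2)), hc] at h
    · have : 2 * (a 0 ^ 2 + a 1 ^ 2 + a 2 ^ 2) = 12 * Fintype.card F := by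
        apply mul_left_cancel₀ hm0
        linear_combination h
      linarith
    · intro j
      induction j with
      | zero => simp only [ha3 0, ha3 1, ha3 2, zero_add]; ring
      | succ j ih =>
        have h6 : a (j + 6) = a j := by rw [ha3 (j + 3), ha3, neg_neg]
        rw [← ih, show j + 1 + 5 = j + 6 by ring, h6]
        ring_nf
  have hall : ∀ j, ∃ u, a j ^ 2 + a j * u + u ^ 2 = 3 * Fintype.card F := by
    have hb : a 1 = a 0 + a 2 := by linarith
    rw [hb] at hquad
    intro j
    induction j using Nat.strong_induction_on with
    | _ j ih =>
      match j, ih with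
      | 0, _ => exact ⟨a 2, by linarith⟩
      | 1, _ => exact ⟨- a 2, by rw [hb]; linarith⟩
      | 2, _ => exact ⟨a 0, by linarith⟩
      | j + 3, ih =>
        obtain ⟨u, hu⟩ := ih j (by omega)
        exact ⟨-u, by rw [ha3]; linarith⟩
  obtain ⟨j, hj⟩ := mem_powers_iff_mem_zpowers.mpr (hg (Units.mk0 k hk))
  have : k = (g : F) ^ j := by
    have := congrArg Units.val hj
    simpa using this.symm
  rw [this, ← ha]
  exact hall j

theorem cubicCharSum_eq_zero (hF : ringChar F ≠ 2) (hq : Fintype.card F % 3 = 2) (k : F) :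
    cubicCharSum k = 0 := by
  have hinj : Function.Injective fun x : F => x ^ 3 := by
    have hco : (Fintype.card Fˣ).Coprime 3 := by
      rw [Nat.coprime_comm, Nat.prime_three.coprime_iff_not_dvd, Fintype.card_units]; omega
    intro x y h
    by_cases hx : x = 0
    · subst hx; simpa [eq_comm (a := (0 : F))] using h
    by_cases hy : y = 0
    · subst hy; simpa using h
    have h' : Units.mk0 x hx ^ 3 = Units.mk0 y hy ^ 3 := Units.ext (by simpa using h)
    have := (powCoprime (by rwa [Nat.card_eq_fintype_card])).injective h'
    simpa using this
  rw [cubicCharSum, ← quadraticChar_sum_zero hF]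
  exact Fintype.sum_bijective (fun x => x ^ 3 + k)
    ((AddGroup.addRight_bijective k).comp (Finite.injective_iff_bijective.mp hinj)) _ _ fun _ => rfl

end CharSums

theorem Npts_eq_add_cubicCharSum {p : ℕ} [Fact p.Prime] (hp : 3 < p) {k : ZMod p} (hk : k ≠ 0) :
    (Npts p k : ℤ) = p + 1 + cubicCharSum k := by
  have hF : ringChar (ZMod p) ≠ 2 := by rw [ZMod.ringChar_zmod_n]; omega
  have h2 : (2 : ZMod p) ≠ 0 := Ring.two_ne_zero hF
  have h3 : (3 : ZMod p) ≠ 0 := by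
    intro h
    have : ((3 : ℕ) : ZMod p) = 0 := by exact_mod_cast h
    rw [ZMod.natCast_eq_zero_iff] at this
    have := Nat.le_of_dvd (by norm_num) this
    omega
  have hns : ∀ x y : ZMod p,
      (WeierstrassCurve.toAffine ⟨0, 0, 0, 0, k⟩).Nonsingular x y ↔ y ^ 2 = x ^ 3 + k := by
    intro x y
    rw [← WeierstrassCurve.Affine.equation_iff_nonsingular_of_Δ_ne_zero,
      WeierstrassCurve.Affine.equation_iff]
    · simp
    · simp only [WeierstrassCurve.Δ, WeierstrassCurve.b₂, WeierstrassCurve.b₄,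
        WeierstrassCurve.b₆, WeierstrassCurve.b₈]
      have : -(2 ^ 4 * 3 ^ 3 * k ^ 2) ≠ 0 := by simp [h2, h3, hk]
      convert this using 1
      ring
  let e : WeierstrassCurve.Affine.Point
      (WeierstrassCurve.toAffine ⟨0, 0, 0, 0, k⟩) ≃
      Option (Σ x : ZMod p, {y : ZMod p // y ^ 2 = x ^ 3 + k}) :=
    { toFun := fun P => match P with
        | .zero => none
        | .some x y h => some ⟨x, y, (hns x y).mp h⟩
      invFun := fun P => match P with
        | none => .zero
        | some ⟨x, y, h⟩ => .some x y ((hns x y).mpr h)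
      left_inv := by rintro (_ | _) <;> rfl
      right_inv := by rintro (_ | _) <;> rfl }
  rw [Npts, Nat.card_congr e, Finite.card_option, Nat.card_sigma]
  have hfib : ∀ x : ZMod p, (Nat.card {y : ZMod p // y ^ 2 = x ^ 3 + k} : ℤ)
      = quadraticChar (ZMod p) (x ^ 3 + k) + 1 := fun x => by
    rw [← quadraticChar_card_sqrts hF, Nat.card_eq_fintype_card, Fintype.card_subtype]
    congr 2
    ext; simp
  push_cast
  simp only [hfib, Finset.sum_add_distrib, cubicCharSum]
  simp
  ring

/-- Two integers congruent to `1` modulo `3` which are both traces of Eisenstein integers of norm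
`p` are traces of associates, by uniqueness of the prime factorization. -/
theorem eisenstein_rep_unique {p : ℕ} (hp : p.Prime) {t u t' u' : ℤ}
    (h : t ^ 2 + t * u + u ^ 2 = 3 * p) (h' : t' ^ 2 + t' * u' + u' ^ 2 = 3 * p)
    (ht : t % 3 = 1) (ht' : t' % 3 = 1) (hne : t ≠ t') :
    t ^ 2 + t * t' + t' ^ 2 = 3 * p := by
  have key : ∀ {x y : ℤ}, x ^ 2 + x * y + y ^ 2 = 3 * p → ∃ s, y = x + 3 * s := by
    intro x y hxy
    have : (3 : ℤ) ∣ (y - x) ^ 2 := ⟨p - x * y, by linear_combination hxy⟩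
    obtain ⟨s, hs⟩ := Int.prime_three.dvd_of_dvd_pow this
    exact ⟨s, by linarith⟩
  obtain ⟨s, rfl⟩ := key h
  obtain ⟨s', rfl⟩ := key h'
  have hp0 : (0 : ℤ) < p := by exact_mod_cast hp.pos
  have hpi : Prime (p : ℤ) := Nat.prime_iff_prime_int.mp hp
  -- with `b = t + 2 s` we have `4 p = t ^ 2 + 3 b ^ 2`
  have main : ∀ b b' : ℤ, 4 * (p : ℤ) = t ^ 2 + 3 * b ^ 2 → 4 * (p : ℤ) = t' ^ 2 + 3 * b' ^ 2 →
      (p : ℤ) ∣ t' * b - t * b' → t ^ 2 + t * t' + t' ^ 2 = 3 * p := by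
    intro b b' hb hb' ⟨m, hm⟩
    have e : (t' * t + 3 * b' * b) ^ 2 = p ^ 2 * (16 - 3 * m ^ 2) := by
      have : (t' * t + 3 * b' * b) ^ 2 + 3 * (t' * b - t * b') ^ 2 = (4 * p) * (4 * p) := by
        nth_rw 1 [hb]; rw [hb']; ring
      rw [hm] at this
      linear_combination this
    have e0 : 4 * p * t' = t * (t' * t + 3 * b' * b) + 3 * b * (p * m) := by
      rw [← hm, hb]; ring
    have hm2 : 3 * m ^ 2 ≤ 16 := by
      by_contra! hcon
      nlinarith [sq_nonneg (t' * t + 3 * b' * b), pow_pos hp0 2]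
    obtain ⟨w, hw⟩ : (p : ℤ) ∣ t' * t + 3 * b' * b :=
      hpi.dvd_of_dvd_pow (n := 2) ⟨p * (16 - 3 * m ^ 2), by rw [e]; ring⟩
    rw [hw] at e e0
    have e1 : w ^ 2 = 16 - 3 * m ^ 2 := by
      have : (p : ℤ) ^ 2 ≠ 0 := by positivity
      apply mul_left_cancel₀ this
      linear_combination e
    have e2 : 4 * t' = t * w + 3 * b * m := by
      apply mul_left_cancel₀ hp0.ne'
      linear_combination e0
    have hm3 : m ≤ 2 := by nlinarith
    have hm4 : -2 ≤ m := by nlinarith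
    have hw3 : w ≤ 4 := by nlinarith
    have hw4 : -4 ≤ w := by nlinarith
    have fin : ∀ v : ℤ, v ^ 2 = 9 * b ^ 2 → 2 * t' = -t + v → t ^ 2 + t * t' + t' ^ 2 = 3 * p := by
      intro v hv h2
      have : v = 2 * t' + t := by linarith
      subst this
      linarith
    interval_cases m <;> interval_cases w <;> first
      | (exfalso; omega)
      | exact fin (3 * b) (by ring) (by linarith)
      | exact fin (-3 * b) (by ring) (by linarith)
  have hb : 4 * (p : ℤ) = t ^ 2 + 3 * (t + 2 * s) ^ 2 := by linarith
  have hb' : 4 * (p : ℤ) = t' ^ 2 + 3 * (t' + 2 * s') ^ 2 := by linarith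
  have hd : (p : ℤ) ∣ (t' * (t + 2 * s) - t * (t' + 2 * s')) * (t' * (t + 2 * s) - t * -(t' + 2 * s')) :=
    ⟨4 * ((t + 2 * s) ^ 2 - (t' + 2 * s') ^ 2), by
      linear_combination (t' + 2 * s') ^ 2 * hb -  (t + 2 * s) ^ 2 * hb'⟩
  rcases hpi.dvd_or_dvd hd with hd | hd
  · exact main _ _ hb hb' hd
  · exact main _ _ hb (by rw [neg_sq]; exact hb') hd

/-- A cycle of `n ≥ 3` distinct primes `p i ≡ 1 (mod 3)` in which each `p i + 1 - p (i + 1)` is the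
trace of an Eisenstein integer of norm `p i` has length `6`. -/
theorem six_of_trace_cycle (n : ℕ) (hn : 3 ≤ n) (p : ℕ → ℕ)
    (hinj : ∀ i < n, ∀ j < n, p i = p j → i = j)
    (hprime : ∀ i < n, (p i).Prime) (h3 : ∀ i < n, 3 < p i)
    (hmod : ∀ i < n, p i % 3 = 1)
    (hcyc : ∀ i < n, ∃ u : ℤ, ((p i : ℤ) + 1 - p ((i + 1) % n)) ^ 2
      + ((p i : ℤ) + 1 - p ((i + 1) % n)) * u + u ^ 2 = 3 * p i) :
    n = 6 := by
  have hn0 : 0 < n := by omega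
  obtain ⟨t, ht⟩ : ∃ t : ℕ → ℤ, ∀ i, t i = (p (i % n) : ℤ) + 1 - p ((i + 1) % n) := ⟨_, fun _ => rfl⟩
  have hpm : ∀ i, p (i % n) % 3 = 1 := fun i => hmod _ (Nat.mod_lt _ hn0)
  have hpo : ∀ i, p (i % n) % 2 = 1 := fun i => by
    have h := hprime _ (Nat.mod_lt i hn0)
    have h' := h3 _ (Nat.mod_lt i hn0)
    exact h.mod_two_eq_one_iff_ne_two.mpr (by omega)
  have hto : ∀ i, t i % 2 = 1 := fun i => by
    have h := hpo i; have h' := hpo (i + 1); rw [ht]; omega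
  have htm : ∀ i, t i % 3 = 1 := fun i => by
    have h := hpm i; have h' := hpm (i + 1); rw [ht]; omega
  have hrep : ∀ i, ∃ u : ℤ, t i ^ 2 + t i * u + u ^ 2 = 3 * p (i % n) := fun i => by
    obtain ⟨u, hu⟩ := hcyc _ (Nat.mod_lt i hn0)
    refine ⟨u, ?_⟩
    rw [ht, ← hu, Nat.mod_add_mod]
  have hquad : ∀ i, (2 - t i) ^ 2 + (2 - t i) * t (i + 1) + t (i + 1) ^ 2
      = 3 * p ((i + 1) % n) := fun i => by
    obtain ⟨u, hu⟩ := hrep i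
    obtain ⟨v, hv⟩ := hrep (i + 1)
    refine eisenstein_rep_unique (u := t i + u - 1) (hprime _ (Nat.mod_lt _ hn0)) ?_ hv ?_ (htm _) ?_
    · linear_combination hu - 3 * ht i
    · have := htm i; omega
    · intro heq
      rw [ht, ht] at heq
      have h1 : p (i % n) = p ((i + 1 + 1) % n) := by omega
      have h2 := hinj _ (Nat.mod_lt _ hn0) _ (Nat.mod_lt _ hn0) h1
      have h3 : i ≡ i + 2 [MOD n] := h2
      have h4 := (Nat.modEq_iff_dvd' (by omega)).mp h3
      have := Nat.le_of_dvd (by omega) h4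
      omega
  have hrec : ∀ i, t (i + 2) = 1 + t (i + 1) - t i := fun i => by
    have h1 := hquad i
    have h2 := hquad (i + 1)
    have h3 := ht (i + 1)
    have : (t (i + 2) - (1 + t (i + 1) - t i)) * (t (i + 2) + (2 - t i) + 1) = 0 := by
      linear_combination h2 - h1 + 3 * h3
    rcases mul_eq_zero.mp this with h | h
    · linarith
    · have := hto (i + 2); have := hto i; omega
  have r0 := hrec 0
  have r1 := hrec 1
  have r2 := hrec 2
  have r3 := hrec 3
  have t0 := ht 0
  have t1 := ht 1
  have t2 := ht 2
  have t3 := ht 3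
  have t4 := ht 4
  have t5 := ht 5
  norm_num at r0 r1 r2 r3 t0 t1 t2 t3 t4 t5
  have h6 : p (6 % n) = p 0 := by omega
  have h6' : 6 % n = 0 := hinj _ (Nat.mod_lt _ hn0) _ hn0 h6
  have hdvd : n ∣ 6 := Nat.dvd_of_mod_eq_zero h6'
  have hle := Nat.le_of_dvd (by norm_num) hdvd
  interval_cases n
  · norm_num at *
    have := hinj 0 (by norm_num) 1 (by norm_num) (by omega)
    omega
  all_goals omega

/-- Theorem 3.3 (`d = 3` part): a proper elliptic `n`-cycle over `3` with `n ≥ 3` must have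
`n = 6`. -/
theorem stmt_9 (n : ℕ) (hn : 3 ≤ n) (p : ℕ → ℕ)
    (hinj : ∀ i < n, ∀ j < n, p i = p j → i = j)
    (hprime : ∀ i < n, (p i).Prime) (h3 : ∀ i < n, 3 < p i)
    (hcyc : ∀ i < n, ∃ k : ZMod (p i), k ≠ 0 ∧ Npts (p i) k = p ((i + 1) % n)) :
    n = 6 := by
  have hodd : ∀ i < n, p i % 2 = 1 := fun i hi =>
    (hprime i hi).mod_two_eq_one_iff_ne_two.mpr (by have := h3 i hi; omega)
  have hdata : ∀ i < n, p i % 3 = 1 ∧ ∃ u : ℤ, ((p i : ℤ) + 1 - p ((i + 1) % n)) ^ 2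
      + ((p i : ℤ) + 1 - p ((i + 1) % n)) * u + u ^ 2 = 3 * p i := fun i hi => by
    have : Fact (p i).Prime := ⟨hprime i hi⟩
    have hp3 := h3 i hi
    have hF : ringChar (ZMod (p i)) ≠ 2 := by rw [ZMod.ringChar_zmod_n]; omega
    obtain ⟨k, hk, hN⟩ := hcyc i hi
    have hcount := Npts_eq_add_cubicCharSum hp3 hk
    rw [hN] at hcount
    have hmod : p i % 3 = 1 := by
      have h0 : p i % 3 ≠ 0 := fun h => by
        have := (Nat.prime_dvd_prime_iff_eq Nat.prime_three (hprime i hi)).mp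
          (Nat.dvd_of_mod_eq_zero h)
        omega
      have h2 : p i % 3 ≠ 2 := fun h => by
        rw [cubicCharSum_eq_zero hF (by rwa [ZMod.card])] at hcount
        have := hodd i hi
        have := hodd _ (Nat.mod_lt (i + 1) (by omega : 0 < n))
        omega
      omega
    obtain ⟨u, hu⟩ := exists_cubicCharSum_form hF (by rwa [ZMod.card]) hk
    rw [ZMod.card] at hu
    refine ⟨hmod, -u, ?_⟩
    rw [hcount]
    linear_combination hu
  exact six_of_trace_cycle n hn p hinj hprime h3 (fun i hi => (hdata i hi).1)
    fun i hi => (hdata i hi).2
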